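/- Let P > 0, σ > 0, G > 0 be real numbers, and let R be a real number such that R < (1/2)·log₂(1 + P/σ²) − (1/2)·log₂(2·π·e·G). For each n ≥ 1, let V_n denote the Lebesgue volume of the Euclidean ball of radius σ·√n centered at the origin in ℝ^n. Then the sequence n ↦ 2^{n·R} · V_n · ( G/(P + σ²) )^{n/2} converges to 0 as n → ∞. -/

import Mathlib

open MeasureTheory Filter

/-- An elementary Stirling-type lower bound for the Gamma function. -/
theorem Real.rpow_mul_exp_neg_le_Gamma_add_one {x : ℝ} (hx : 0 ≤ x) :
    x ^ x * Real.exp (-x) ≤ Real.Gamma (x + 1) := by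
  have hint : IntegrableOn (fun t : ℝ => Real.exp (-t) * t ^ x) (Set.Ioi 0) := by
    simpa using Real.GammaIntegral_convergent (s := x + 1) (by linarith)
  have hsub : Set.Ioi x ⊆ Set.Ioi (0 : ℝ) := Set.Ioi_subset_Ioi hx
  calc x ^ x * Real.exp (-x) = ∫ t in Set.Ioi x, Real.exp (-t) * x ^ x := by
        rw [integral_mul_const, integral_exp_neg_Ioi, mul_comm]
    _ ≤ ∫ t in Set.Ioi x, Real.exp (-t) * t ^ x := by
        refine setIntegral_mono_on ((integrableOn_exp_neg_Ioi x).mul_const _)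
          (hint.mono_set hsub) measurableSet_Ioi fun t ht => ?_
        have : x ≤ t := le_of_lt ht
        gcongr
    _ ≤ ∫ t in Set.Ioi 0, Real.exp (-t) * t ^ x := by
        refine setIntegral_mono_set hint ?_ hsub.eventuallyLE
        filter_upwards [ae_restrict_mem measurableSet_Ioi] with t ht
        have : (0 : ℝ) < t := ht
        simp only [Pi.zero_apply]
        positivity
    _ = Real.Gamma (x + 1) := by
        rw [Real.Gamma_eq_integral (by linarith)]
        simp

/-- The volume of the ball of radius `r√n` in `ℝⁿ` is at most `(2πe r²)^{n/2}`. -/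
theorem EuclideanSpace.toReal_volume_ball_mul_sqrt_le {r : ℝ} (hr : 0 < r) {n : ℕ} (hn : 0 < n) :
    (volume (Metric.ball (0 : EuclideanSpace ℝ (Fin n)) (r * Real.sqrt n))).toReal
      ≤ Real.exp (n * (Real.log r + Real.log (2 * Real.pi) / 2 + 1 / 2)) := by
  have : Nonempty (Fin n) := ⟨⟨0, hn⟩⟩
  have hn' : (0 : ℝ) < n := by exact_mod_cast hn
  have hπ := Real.pi_pos
  have hlow := Real.rpow_mul_exp_neg_le_Gamma_add_one (x := (n : ℝ) / 2) (by positivity)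
  have hΓ : 0 < Real.Gamma ((n : ℝ) / 2 + 1) := Real.Gamma_pos_of_pos (by positivity)
  rw [EuclideanSpace.volume_ball, Fintype.card_fin, ENNReal.toReal_mul, ENNReal.toReal_pow,
    ENNReal.toReal_ofReal (by positivity), ENNReal.toReal_ofReal (by positivity), ← mul_div_assoc,
    div_le_iff₀ hΓ]
  refine le_trans (le_of_eq ?_) (mul_le_mul_of_nonneg_left hlow (Real.exp_pos _).le)
  have hpow (y : ℝ) (hy : 0 < y) : y ^ n = Real.exp (Real.log y * n) := by
    rw [← Real.rpow_natCast, Real.rpow_def_of_pos hy]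
  rw [hpow _ (by positivity), hpow _ (by positivity), Real.rpow_def_of_pos (by positivity),
    ← Real.exp_add, ← Real.exp_add, ← Real.exp_add, Real.log_mul hr.ne' (by positivity),
    Real.log_sqrt hn'.le, Real.log_sqrt hπ.le, Real.log_mul two_ne_zero hπ.ne',
    Real.log_div hn'.ne' two_ne_zero]
  ring_nf

/-- Theorem 1, analytic form: if the rate `R` per signal dimension is below
`(1/2)log₂(1 + P/σ²) − (1/2)log₂(2πeG)`, then the union bound
`2^{nR} · V_n · (G/(P + σ²))^{n/2}`, where `V_n` is the volume of the noise ball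
of radius `σ√n` in `ℝⁿ`, tends to `0` as `n → ∞`. -/
theorem stmt_11 (P σ G R : ℝ) (hP : 0 < P) (hσ : 0 < σ) (hG : 0 < G)
    (hR : R < (1 / 2) * Real.logb 2 (1 + P / σ ^ 2)
      - (1 / 2) * Real.logb 2 (2 * Real.pi * Real.exp 1 * G)) :
    Tendsto
      (fun n : ℕ => (2 : ℝ) ^ ((n : ℝ) * R)
        * (volume (Metric.ball (0 : EuclideanSpace ℝ (Fin n)) (σ * Real.sqrt n))).toReal
        * (G / (P + σ ^ 2)) ^ ((n : ℝ) / 2))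
      atTop (nhds 0) := by
  have hπ := Real.pi_pos
  have hl2 : 0 < Real.log 2 := Real.log_pos one_lt_two
  set c := R * Real.log 2 + (Real.log σ + Real.log (2 * Real.pi) / 2 + 1 / 2)
    + Real.log (G / (P + σ ^ 2)) / 2 with hc
  have hc0 : c < 0 := by
    have h1 : 1 + P / σ ^ 2 = (P + σ ^ 2) / σ ^ 2 := by field_simp; ring
    rw [h1, Real.logb, Real.logb, Real.log_div (by positivity) (by positivity),
      Real.log_mul (by positivity) hG.ne', Real.log_mul (by positivity) (by positivity),
      Real.log_exp, Real.log_pow, ← mul_div_assoc, ← mul_div_assoc, ← sub_div,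
      lt_div_iff₀ hl2] at hR
    rw [hc, Real.log_div hG.ne' (by positivity)]
    push_cast at hR
    linarith
  have hlim : Tendsto (fun n : ℕ => Real.exp c ^ n) atTop (nhds 0) :=
    tendsto_pow_atTop_nhds_zero_of_lt_one (Real.exp_pos c).le (by simpa using hc0)
  refine squeeze_zero' (Eventually.of_forall fun n => by positivity) ?_ hlim
  filter_upwards [eventually_gt_atTop 0] with n hn
  calc (2 : ℝ) ^ ((n : ℝ) * R)
        * (volume (Metric.ball (0 : EuclideanSpace ℝ (Fin n)) (σ * Real.sqrt n))).toReal
        * (G / (P + σ ^ 2)) ^ ((n : ℝ) / 2)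
      ≤ (2 : ℝ) ^ ((n : ℝ) * R)
        * Real.exp (n * (Real.log σ + Real.log (2 * Real.pi) / 2 + 1 / 2))
        * (G / (P + σ ^ 2)) ^ ((n : ℝ) / 2) := by
        gcongr
        exact EuclideanSpace.toReal_volume_ball_mul_sqrt_le hσ hn
    _ = Real.exp c ^ n := by
        rw [Real.rpow_def_of_pos two_pos, Real.rpow_def_of_pos (by positivity), ← Real.exp_add,
          ← Real.exp_add, ← Real.exp_nat_mul, hc]
        congr 1
        ring
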